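/- (Corollary 4.) Assume (A0), and let $a_0>0$, $\rho_0>0$ satisfy $4\pi G(\rho_0+3P(\rho_0)/c^2)<c^2\Lambda$. Then there exists $\epsilon>0$, depending on $a_0$ and $\rho_0$, such that for every $\dot a_0$ with $-\epsilon\le\dot a_0<0$, the solution $(a,\rho)$ of the Friedmann system with initial data $a(0)=a_0$, $a'(0)=\dot a_0$, $\rho(0)=\rho_0$, on its maximal interval of existence $]t_-,t_+[$ in $\{a>0,\ \rho>0\}$, satisfies: $t_+=+\infty$, and $a(t)\to+\infty$ and $\rho(t)\to 0$ as $t\to+\infty$. -/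

import Mathlib

open Real Filter Set Topology

/-- Assumption (A0): `P` is a smooth function of `ρ > 0` with `0 ≤ P`,
`0 ≤ dP/dρ < c²` for `ρ > 0`, and `P → 0` as `ρ → 0⁺`. -/
def A0 (c : ℝ) (P : ℝ → ℝ) : Prop :=
  ContDiffOn ℝ (⊤ : ℕ∞) P (Set.Ioi 0) ∧
  (∀ ρ > (0 : ℝ), 0 ≤ P ρ) ∧
  (∀ ρ > (0 : ℝ), 0 ≤ deriv P ρ ∧ deriv P ρ < c ^ 2) ∧
  Filter.Tendsto P (nhdsWithin 0 (Set.Ioi 0)) (nhds 0)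

/-- A solution of the Friedmann system on a set `I`: `a > 0`, `ρ > 0`,
`a'' = (-(4πG/3)(ρ + 3P(ρ)/c²) + c²Λ/3) a` and `ρ' = -3(ρ + P(ρ)/c²) a'/a`. -/
def IsFriedmannSolution (c G Λ : ℝ) (P : ℝ → ℝ) (a ρ : ℝ → ℝ) (I : Set ℝ) : Prop :=
  ∀ t ∈ I, 0 < a t ∧ 0 < ρ t ∧
    DifferentiableAt ℝ a t ∧
    HasDerivAt (deriv a)
      ((-(4 * Real.pi * G / 3) * (ρ t + 3 * P (ρ t) / c ^ 2) + c ^ 2 * Λ / 3) * a t) t ∧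
    HasDerivAt ρ (-3 * (ρ t + P (ρ t) / c ^ 2) * (deriv a t / a t)) t

/-- `(a, ρ)` is a solution of the Friedmann system on the maximal interval of existence
`]t₋, t₊[` (with `-∞ ≤ t₋ < 0 < t₊ ≤ +∞`) in the domain `{a > 0, ρ > 0}`: the solution
property holds on `]t₋, t₊[`, and any solution with the same initial data at `t = 0`
is defined on a subinterval of `]t₋, t₊[`. -/
def IsMaximalSolution (c G Λ : ℝ) (P : ℝ → ℝ) (a ρ : ℝ → ℝ) (tm tp : EReal) : Prop :=
  tm < (0 : EReal) ∧ (0 : EReal) < tp ∧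
  IsFriedmannSolution c G Λ P a ρ {t : ℝ | tm < (t : EReal) ∧ (t : EReal) < tp} ∧
  ∀ (b σ : ℝ → ℝ) (s u : ℝ), s < 0 → 0 < u →
    IsFriedmannSolution c G Λ P b σ (Set.Ioo s u) →
    b 0 = a 0 → deriv b 0 = deriv a 0 → σ 0 = ρ 0 →
    tm ≤ (s : EReal) ∧ (u : EReal) ≤ tp


theorem A0.le_mul {c : ℝ} {P : ℝ → ℝ} (h : A0 c P) {r : ℝ} (hr : 0 < r) : P r ≤ c ^ 2 * r := by
  obtain ⟨hsmooth, -, hderiv, hlim⟩ := h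
  have hd : ∀ x ∈ Ioi (0 : ℝ), HasDerivAt P (deriv P x) x := fun x hx =>
    ((hsmooth.differentiableOn (by simp)).differentiableAt (Ioi_mem_nhds hx)).hasDerivAt
  have hanti : AntitoneOn (fun x => P x - c ^ 2 * x) (Ioi 0) := by
    have hd' : ∀ x ∈ Ioi (0 : ℝ), HasDerivAt (fun x => P x - c ^ 2 * x) (deriv P x - c ^ 2) x := by
      intro x hx
      exact ((hd x hx).sub ((hasDerivAt_id x).const_mul (c ^ 2))).congr_deriv (by simp)
    refine antitoneOn_of_hasDerivWithinAt_nonpos (f' := fun x => deriv P x - c ^ 2) (convex_Ioi 0)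
      (fun x hx => (hd' x hx).continuousAt.continuousWithinAt) ?_ ?_
    · intro x hx
      exact (hd' x (interior_subset hx)).hasDerivWithinAt
    · intro x hx
      linarith [(hderiv x (interior_subset hx)).2]
  have hl : Tendsto (fun x => P x - c ^ 2 * x) (𝓝[>] 0) (𝓝 0) := by
    have h2 : Tendsto (fun x : ℝ => c ^ 2 * x) (𝓝[>] 0) (𝓝 0) := by
      have : Continuous fun x : ℝ => c ^ 2 * x := by fun_prop
      simpa using (this.tendsto 0).mono_left nhdsWithin_le_nhds
    simpa using hlim.sub h2
  have hle : P r - c ^ 2 * r ≤ 0 := by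
    refine ge_of_tendsto hl ?_
    filter_upwards [Ioo_mem_nhdsGT hr] with x hx
    exact hanti hx.1 hr hx.2.le
  linarith

theorem A0.monotoneOn {c : ℝ} {P : ℝ → ℝ} (h : A0 c P) : MonotoneOn P (Ioi 0) := by
  obtain ⟨hsmooth, -, hderiv, -⟩ := h
  refine monotoneOn_of_deriv_nonneg (convex_Ioi 0) hsmooth.continuousOn
    ((hsmooth.differentiableOn (by simp)).mono interior_subset) ?_
  intro x hx
  exact (hderiv x (interior_subset hx)).1

theorem hasDerivAt_min_zero_sq (x : ℝ) :
    HasDerivAt (fun y : ℝ => (min y 0) ^ 2) (2 * min x 0) x := by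
  rcases lt_trichotomy x 0 with hx | rfl | hx
  · rw [min_eq_left hx.le]
    have h : HasDerivAt (fun y : ℝ => y ^ 2) (2 * x) x := by simpa using hasDerivAt_pow 2 x
    refine h.congr_of_eventuallyEq ?_
    filter_upwards [Iio_mem_nhds hx] with y hy
    rw [min_eq_left (le_of_lt hy)]
  · have h : (fun y : ℝ => (min y 0) ^ 2) =O[𝓝 0] fun y => ‖y - 0‖ ^ 2 := by
      refine Asymptotics.IsBigO.of_bound 1 (Eventually.of_forall fun y => ?_)
      simp only [norm_pow, Real.norm_eq_abs, sub_zero, abs_abs, one_mul]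
      rcases le_total y 0 with hy | hy
      · simp [hy]
      · simp [hy]
    have h2 := (h.hasFDerivAt (𝕜 := ℝ) one_lt_two).hasDerivAt
    simpa using h2
  · rw [min_eq_right hx.le]
    refine ((hasDerivAt_const x (0 : ℝ)).congr_of_eventuallyEq ?_).congr_deriv (by simp)
    filter_upwards [Ioi_mem_nhds hx] with y hy
    simp [min_eq_right (mem_Ioi.1 hy).le]

theorem monotoneOn_of_hasDerivAt_nonneg {D : Set ℝ} (hD : Convex ℝ D) {f f' : ℝ → ℝ}
    (hf : ∀ x ∈ D, HasDerivAt f (f' x) x) (hf' : ∀ x ∈ D, 0 ≤ f' x) : MonotoneOn f D :=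
  monotoneOn_of_hasDerivWithinAt_nonneg hD
    (fun x hx => (hf x hx).continuousAt.continuousWithinAt)
    (fun x hx => (hf x (interior_subset hx)).hasDerivWithinAt)
    (fun x hx => hf' x (interior_subset hx))

theorem antitoneOn_of_hasDerivAt_nonpos {D : Set ℝ} (hD : Convex ℝ D) {f f' : ℝ → ℝ}
    (hf : ∀ x ∈ D, HasDerivAt f (f' x) x) (hf' : ∀ x ∈ D, f' x ≤ 0) : AntitoneOn f D :=
  antitoneOn_of_hasDerivWithinAt_nonpos hD
    (fun x hx => (hf x hx).continuousAt.continuousWithinAt)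
    (fun x hx => (hf x (interior_subset hx)).hasDerivWithinAt)
    (fun x hx => hf' x (interior_subset hx))

/-- A function with bounded derivative on `[t₀, T[` has a limit at `T`. -/
theorem exists_tendsto_nhdsLT_of_hasDerivAt_bounded {f f' : ℝ → ℝ} {t₀ T C : ℝ} (hT : t₀ < T)
    (hf : ∀ t ∈ Ico t₀ T, HasDerivAt f (f' t) t) (hC : ∀ t ∈ Ico t₀ T, |f' t| ≤ C) :
    ∃ z, Tendsto f (𝓝[<] T) (𝓝 z) := by
  have hC0 : 0 ≤ C := (abs_nonneg _).trans (hC t₀ ⟨le_rfl, hT⟩)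
  have hlip : LipschitzOnWith C.toNNReal f (Ico t₀ T) := by
    refine (convex_Ico t₀ T).lipschitzOnWith_of_nnnorm_hasDerivWithin_le
      (fun t ht => (hf t ht).hasDerivWithinAt) fun t ht => ?_
    rw [← NNReal.coe_le_coe, coe_nnnorm, Real.norm_eq_abs, Real.coe_toNNReal _ hC0]
    exact hC t ht
  obtain ⟨g, hg, hfg⟩ := hlip.extend_real
  refine ⟨g T, ((hg.continuous.tendsto T).mono_left nhdsWithin_le_nhds).congr' ?_⟩
  filter_upwards [Ico_mem_nhdsLT hT] with t ht
  exact (hfg ht).symm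

/-- An integral curve of an autonomous vector field on `]s, T[` with a limit at `T`, near which the
field is `C¹`, extends past `T`. -/
theorem exists_extension_of_tendsto {E : Type*} [NormedAddCommGroup E] [NormedSpace ℝ E]
    [CompleteSpace E] {F : E → E} {x : ℝ → E} {s T : ℝ} {z : E} (hs : s < T)
    (hx : ∀ t ∈ Ioo s T, HasDerivAt x (F (x t)) t) (hz : Tendsto x (𝓝[<] T) (𝓝 z))
    (hF : ContDiffAt ℝ 1 F z) :
    ∃ δ > 0, ∃ y : ℝ → E, (∀ t < T, y t = x t) ∧ y T = z ∧
      ∀ t ∈ Ioo s (T + δ), HasDerivAt y (F (y t)) t := by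
  obtain ⟨α, hα0, δ, hδ, hα⟩ :=
    hF.exists_forall_mem_closedBall_exists_eq_forall_mem_Ioo_hasDerivAt₀ T
  classical
  set y : ℝ → E := fun t => if t < T then x t else α t with hy
  have hyl : ∀ t < T, y t = x t := fun t ht => by simp [hy, ht]
  have hyr : ∀ t, T ≤ t → y t = α t := fun t ht => by simp [hy, not_lt.2 ht]
  have hyT : y T = z := by rw [hyr T le_rfl, hα0]
  refine ⟨δ, hδ, y, hyl, hyT, fun t ht => ?_⟩
  rcases lt_trichotomy t T with h | rfl | h
  · rw [hyl t h]
    refine (hx t ⟨ht.1, h⟩).congr_of_eventuallyEq ?_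
    filter_upwards [Iio_mem_nhds h] with r hr using hyl r hr
  · have hright : HasDerivWithinAt y (F (y t)) (Ici t) t := by
      have h1 := (hα t ⟨by linarith, by linarith⟩).hasDerivWithinAt (s := Ici t)
      rw [hyr t le_rfl]
      exact h1.congr (fun r hr => hyr r hr) (hyr t le_rfl)
    have hleft : HasDerivWithinAt y (F (y t)) (Iic t) t := by
      have hder : ∀ r ∈ Ioo s t, HasDerivAt y (F (x r)) r := fun r hr =>
        (hx r hr).congr_of_eventuallyEq (by
          filter_upwards [Iio_mem_nhds hr.2] with q hq using hyl q hq)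
      have hmem : Ioo s t ∈ 𝓝[<] t := Ioo_mem_nhdsLT hs
      refine hasDerivWithinAt_Iic_of_tendsto_deriv (s := Ioo s t)
        (fun r hr => (hder r hr).differentiableAt.differentiableWithinAt) ?_ hmem ?_
      · rw [ContinuousWithinAt, hyT]
        refine (hz.mono_left (nhdsWithin_mono _ fun r hr => hr.2)).congr' ?_
        filter_upwards [self_mem_nhdsWithin] with r hr using (hyl r hr.2).symm
      · rw [hyT]
        refine (hF.continuousAt.tendsto.comp hz).congr' ?_
        filter_upwards [hmem] with r hr using (hder r hr).deriv.symm
    have := hleft.union hright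
    rwa [Iic_union_Ici, hasDerivWithinAt_univ] at this
  · rw [hyr t h.le]
    refine (hα t ⟨by linarith, ht.2⟩).congr_of_eventuallyEq ?_
    filter_upwards [Ioi_mem_nhds h] with r hr using hyr r (le_of_lt hr)

/-- As long as `a ≥ a₁` and `κ ≥ k`, the contraction phase of `a'' = κ a` moves `a` and `ρ` only
by amounts quadratic in the initial contraction rate. -/
theorem bounds_of_acceleration {a v ρ p κ : ℝ → ℝ} {a₁ k b : ℝ} (ha₁ : 0 < a₁) (hk : 0 < k)
    (hb : 0 ≤ b) (ha : ∀ t ∈ Icc 0 b, HasDerivAt a (v t) t)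
    (hv : ∀ t ∈ Icc 0 b, HasDerivAt v (κ t * a t) t)
    (hρ : ∀ t ∈ Icc 0 b, HasDerivAt ρ (-3 * (ρ t + p t) * (v t / a t)) t)
    (hp : ∀ t ∈ Icc 0 b, 0 ≤ p t ∧ p t ≤ ρ t)
    (hle : ∀ t ∈ Icc 0 b, a₁ ≤ a t) (hκ : ∀ t ∈ Icc 0 b, k ≤ κ t) :
    a 0 - 1 / (2 * (k * a₁)) * (min (v 0) 0) ^ 2 ≤ a b ∧
      ρ b ≤ ρ 0 * exp (3 / (a₁ * (k * a₁)) * (min (v 0) 0) ^ 2) := by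
  set m := k * a₁ with hm
  have hm0 : 0 < m := mul_pos hk ha₁
  have hacc : ∀ t ∈ Icc 0 b, m ≤ κ t * a t := fun t ht =>
    mul_le_mul (hκ t ht) (hle t ht) ha₁.le (hk.le.trans (hκ t ht))
  have hq : ∀ t ∈ Icc 0 b, HasDerivAt (fun t => (min (v t) 0) ^ 2)
      (2 * min (v t) 0 * (κ t * a t)) t := fun t ht =>
    (hasDerivAt_min_zero_sq (v t)).comp t (hv t ht)
  have h0 : (0 : ℝ) ∈ Icc 0 b := ⟨le_rfl, hb⟩
  have hbb : b ∈ Icc 0 b := ⟨hb, le_rfl⟩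
  constructor
  · have hmono := monotoneOn_of_hasDerivAt_nonneg (convex_Icc 0 b)
      (fun t ht => (ha t ht).sub ((hq t ht).const_mul (1 / (2 * m)))) (fun t ht => by
        rcases le_total (v t) 0 with h | h
        · rw [min_eq_left h]
          have : 1 / (2 * m) * (2 * v t * (κ t * a t)) ≤ 1 / (2 * m) * (2 * v t * m) :=
            mul_le_mul_of_nonneg_left
              (mul_le_mul_of_nonpos_left (hacc t ht) (by linarith)) (by positivity)
          have h2 : 1 / (2 * m) * (2 * v t * m) = v t := by field_simp
          linarith
        · simpa [min_eq_right h] using h)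
    have h1 := hmono h0 hbb hb
    simp only [Pi.sub_apply] at h1
    have h2 : 0 ≤ 1 / (2 * m) * (min (v b) 0) ^ 2 := by positivity
    linarith
  · set l := 3 / (a₁ * m) with hl
    have hanti := antitoneOn_of_hasDerivAt_nonpos (convex_Icc 0 b)
      (fun t ht => (hρ t ht).mul ((hq t ht).const_mul l).exp) (fun t ht => by
        have hat : 0 < a t := ha₁.trans_le (hle t ht)
        obtain ⟨hp0, hp1⟩ := hp t ht
        have hfac : -3 * (ρ t + p t) * (v t / a t) + ρ t * (l * (2 * min (v t) 0 * (κ t * a t)))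
            ≤ 0 := by
          rcases le_total (v t) 0 with h | h
          · rw [min_eq_left h]
            have e1 : -3 * (ρ t + p t) * (v t / a t) ≤ 6 * ρ t * (-v t / a₁) := by
              have e2 : -v t / a t ≤ -v t / a₁ :=
                div_le_div_of_nonneg_left (by linarith) ha₁ (hle t ht)
              have e3 : 0 ≤ -v t / a t := div_nonneg (by linarith) hat.le
              calc -3 * (ρ t + p t) * (v t / a t) = 3 * (ρ t + p t) * (-v t / a t) := by ring
                _ ≤ 6 * ρ t * (-v t / a t) := mul_le_mul_of_nonneg_right (by linarith) e3
                _ ≤ 6 * ρ t * (-v t / a₁) := mul_le_mul_of_nonneg_left e2 (by linarith)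
            have e4 : l * (2 * v t * (κ t * a t)) ≤ l * (2 * v t * m) :=
              mul_le_mul_of_nonneg_left
                (mul_le_mul_of_nonpos_left (hacc t ht) (by linarith)) (by positivity)
            have e5 : l * (2 * v t * m) = -(6 * (-v t / a₁)) := by
              rw [hl]; field_simp; ring
            rw [e5] at e4
            have e6 := mul_le_mul_of_nonneg_left e4 (hp0.trans hp1)
            linarith
          · rw [min_eq_right h]
            have : 0 ≤ 3 * (ρ t + p t) * (v t / a t) :=
              mul_nonneg (by linarith) (div_nonneg h hat.le)
            linarith
        have := mul_nonpos_of_nonpos_of_nonneg hfac (exp_pos (l * (min (v t) 0) ^ 2)).le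
        refine le_of_eq_of_le ?_ this
        ring)
    have h1 := hanti h0 hbb hb
    simp only [Pi.mul_apply] at h1
    have h2 : 1 ≤ exp (l * (min (v b) 0) ^ 2) := one_le_exp (by positivity)
    have h3 : 0 ≤ ρ b := (hp b hbb).1.trans (hp b hbb).2
    exact (le_mul_of_one_le_right h3 h2).trans h1

/-- A maximal solution cannot converge to a point of the domain at a finite final time. -/
theorem IsMaximalSolution.not_tendsto {c G Λ : ℝ} {P a ρ : ℝ → ℝ} {tm : EReal} {T : ℝ}
    (h : IsMaximalSolution c G Λ P a ρ tm (T : EReal)) (hP : ContDiffOn ℝ (⊤ : ℕ∞) P (Ioi 0))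
    {za zv zρ : ℝ} (hza : 0 < za) (hzρ : 0 < zρ) (ha : Tendsto a (𝓝[<] T) (𝓝 za))
    (hv : Tendsto (deriv a) (𝓝[<] T) (𝓝 zv)) (hρ : Tendsto ρ (𝓝[<] T) (𝓝 zρ)) : False := by
  obtain ⟨htm, hT, hsol, hmax⟩ := h
  have hT0 : 0 < T := by exact_mod_cast hT
  obtain ⟨s, hs1, hs2⟩ := EReal.lt_iff_exists_real_btwn.1 htm
  have hs0 : s < 0 := by exact_mod_cast hs2
  have hmem : ∀ t ∈ Ioo s T, t ∈ {t : ℝ | tm < (t : EReal) ∧ (t : EReal) < T} := fun t ht =>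
    ⟨hs1.trans (by exact_mod_cast ht.1), by exact_mod_cast ht.2⟩
  let F : ℝ × ℝ × ℝ → ℝ × ℝ × ℝ := fun p =>
    (p.2.1, (-(4 * Real.pi * G / 3) * (p.2.2 + 3 * P p.2.2 / c ^ 2) + c ^ 2 * Λ / 3) * p.1,
      -3 * (p.2.2 + P p.2.2 / c ^ 2) * (p.2.1 / p.1))
  have hF : ContDiffAt ℝ 1 F (za, zv, zρ) := by
    have hP1 : ContDiffAt ℝ 1 P zρ :=
      (hP.contDiffAt (Ioi_mem_nhds hzρ)).of_le (by exact_mod_cast le_top)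
    have hP2 : ContDiffAt ℝ 1 (fun p : ℝ × ℝ × ℝ => P p.2.2) (za, zv, zρ) :=
      ContDiffAt.comp (za, zv, zρ) (g := P) (f := fun p : ℝ × ℝ × ℝ => p.2.2) hP1
        (by fun_prop)
    have hne : ((za, zv, zρ) : ℝ × ℝ × ℝ).1 ≠ 0 := hza.ne'
    have h1 : ContDiffAt ℝ 1 (fun p : ℝ × ℝ × ℝ => p.2.1 / p.1) (za, zv, zρ) :=
      ContDiffAt.div (by fun_prop) (by fun_prop) hne
    refine ContDiffAt.prodMk (by fun_prop) (ContDiffAt.prodMk ?_ ?_)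
    · simp only [div_eq_mul_inv]
      fun_prop
    · refine ContDiffAt.mul ?_ h1
      simp only [div_eq_mul_inv]
      fun_prop
  obtain ⟨δ, hδ, y, hyl, hyT, hy⟩ := exists_extension_of_tendsto (F := F)
    (x := fun t => (a t, deriv a t, ρ t)) (z := (za, zv, zρ)) (hs0.trans hT0)
    (fun t ht => by
      obtain ⟨-, -, h1, h2, h3⟩ := hsol t (hmem t ht)
      exact h1.hasDerivAt.prodMk (h2.prodMk h3))
    (ha.prodMk_nhds (hv.prodMk_nhds hρ)) hF
  have hcont : ContinuousAt y T :=
    (hy T ⟨hs0.trans hT0, by linarith⟩).continuousAt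
  have hpos : ∀ᶠ t in 𝓝 T, 0 < (y t).1 ∧ 0 < (y t).2.2 := by
    have h1 : ContinuousAt (fun t => (y t).1) T := hcont.fst
    have h2 : ContinuousAt (fun t => (y t).2.2) T := hcont.snd.snd
    refine (h1.eventually (lt_mem_nhds ?_)).and (h2.eventually (lt_mem_nhds ?_))
    · simpa [hyT] using hza
    · simpa [hyT] using hzρ
  obtain ⟨η, hη, hηpos⟩ := Metric.eventually_nhds_iff.1 hpos
  set u := T + min δ η with hu
  have hmin : 0 < min δ η := lt_min hδ hη
  have hder : ∀ t ∈ Ioo s u, HasDerivAt y (F (y t)) t := fun t ht =>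
    hy t ⟨ht.1, ht.2.trans_le (by rw [hu]; gcongr; exact min_le_left _ _)⟩
  have hder1 : ∀ t ∈ Ioo s u, HasDerivAt (fun t => (y t).1) (y t).2.1 t := fun t ht =>
    (hasFDerivAt_fst (𝕜 := ℝ) (p := y t)).comp_hasDerivAt t (hder t ht)
  have hder2 : ∀ t ∈ Ioo s u, HasDerivAt (fun t => (y t).2) (F (y t)).2 t := fun t ht =>
    (hasFDerivAt_snd (𝕜 := ℝ) (p := y t)).comp_hasDerivAt t (hder t ht)
  have hnew : IsFriedmannSolution c G Λ P (fun t => (y t).1) (fun t => (y t).2.2) (Ioo s u) := by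
    intro t ht
    have hpt : 0 < (y t).1 ∧ 0 < (y t).2.2 := by
      rcases lt_or_ge t T with h | h
      · rw [hyl t h]
        obtain ⟨h1, h2, -⟩ := hsol t (hmem t ⟨ht.1, h⟩)
        exact ⟨h1, h2⟩
      · refine hηpos ?_
        rw [Real.dist_eq, abs_of_nonneg (by linarith)]
        linarith [ht.2, min_le_right δ η]
    have hd : deriv (fun t => (y t).1) =ᶠ[𝓝 t] fun t => (y t).2.1 := by
      filter_upwards [Ioo_mem_nhds ht.1 ht.2] with r hr using (hder1 r hr).deriv
    have h21 : HasDerivAt (fun t => (y t).2.1) (F (y t)).2.1 t :=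
      (ContinuousLinearMap.fst ℝ ℝ ℝ).hasFDerivAt.comp_hasDerivAt t (hder2 t ht)
    have h22 : HasDerivAt (fun t => (y t).2.2) (F (y t)).2.2 t :=
      (ContinuousLinearMap.snd ℝ ℝ ℝ).hasFDerivAt.comp_hasDerivAt t (hder2 t ht)
    refine ⟨hpt.1, hpt.2, (hder1 t ht).differentiableAt, ?_, ?_⟩
    · exact h21.congr_of_eventuallyEq hd
    · rw [(hder1 t ht).deriv]
      exact h22
  have hea : (fun t => (y t).1) =ᶠ[𝓝 0] a := by
    filter_upwards [Iio_mem_nhds hT0] with t ht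
    rw [hyl t ht]
  have hle := (hmax _ _ s u hs0 (by linarith) hnew hea.eq_of_nhds hea.deriv_eq
    (by rw [hyl 0 hT0])).2
  have : u ≤ T := by exact_mod_cast hle
  linarith

/-- The choice of the thresholds: a density bound `ρ₁` below which the expansion accelerates, and a
bound `ε` on the initial contraction rate. -/
theorem exists_thresholds {c G Λ : ℝ} {P : ℝ → ℝ} (hG : 0 < G) (hA0 : A0 c P) {a0 ρ0 : ℝ}
    (ha0 : 0 < a0) (hρ0 : 0 < ρ0)
    (hcond : 4 * Real.pi * G * (ρ0 + 3 * P ρ0 / c ^ 2) < c ^ 2 * Λ) :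
    ∃ ρ₁ k ε : ℝ, ρ0 < ρ₁ ∧ 0 < k ∧ 0 < ε ∧
      (∀ r, 0 < r → r ≤ ρ₁ →
        k ≤ -(4 * Real.pi * G / 3) * (r + 3 * P r / c ^ 2) + c ^ 2 * Λ / 3) ∧
      a0 / 2 < a0 - 1 / (2 * (k * (a0 / 2))) * ε ^ 2 ∧
      ρ0 * exp (3 / (a0 / 2 * (k * (a0 / 2))) * ε ^ 2) < ρ₁ := by
  have hPc : ContinuousAt P ρ0 := hA0.1.continuousOn.continuousAt (Ioi_mem_nhds hρ0)
  have hev : ∀ᶠ r in 𝓝[>] ρ0,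
      0 < -(4 * Real.pi * G / 3) * (r + 3 * P r / c ^ 2) + c ^ 2 * Λ / 3 := by
    have hc : ContinuousAt
        (fun r => -(4 * Real.pi * G / 3) * (r + 3 * P r / c ^ 2) + c ^ 2 * Λ / 3) ρ0 := by
      simp only [div_eq_mul_inv]
      fun_prop
    exact (hc.eventually (lt_mem_nhds (by linarith))).filter_mono nhdsWithin_le_nhds
  obtain ⟨ρ₁, hk, hρ₁⟩ := (hev.and self_mem_nhdsWithin).exists
  set k := -(4 * Real.pi * G / 3) * (ρ₁ + 3 * P ρ₁ / c ^ 2) + c ^ 2 * Λ / 3 with hkdef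
  have h1 : ∀ᶠ ε in 𝓝[>] (0 : ℝ), a0 / 2 < a0 - 1 / (2 * (k * (a0 / 2))) * ε ^ 2 := by
    have hc : Continuous fun ε : ℝ => a0 - 1 / (2 * (k * (a0 / 2))) * ε ^ 2 := by fun_prop
    refine (hc.continuousAt.eventually (lt_mem_nhds ?_)).filter_mono nhdsWithin_le_nhds
    simp [ha0]
  have h2 : ∀ᶠ ε in 𝓝[>] (0 : ℝ), ρ0 * exp (3 / (a0 / 2 * (k * (a0 / 2))) * ε ^ 2) < ρ₁ := by
    have hc : Continuous fun ε : ℝ => ρ0 * exp (3 / (a0 / 2 * (k * (a0 / 2))) * ε ^ 2) := by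
      fun_prop
    refine (hc.continuousAt.eventually (gt_mem_nhds ?_)).filter_mono nhdsWithin_le_nhds
    simpa using hρ₁
  obtain ⟨ε, ⟨h1, h2⟩, hε⟩ := ((h1.and h2).and self_mem_nhdsWithin).exists
  refine ⟨ρ₁, k, ε, hρ₁, hk, hε, fun r hr hr1 => ?_, h1, h2⟩
  have hP := hA0.monotoneOn hr (hr.trans_le hr1) hr1
  have : r + 3 * P r / c ^ 2 ≤ ρ₁ + 3 * P ρ₁ / c ^ 2 := by gcongr
  have := mul_le_mul_of_nonneg_left this (show 0 ≤ 4 * Real.pi * G / 3 by positivity)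
  rw [hkdef]
  linarith

theorem A0.div_mem {c : ℝ} {P : ℝ → ℝ} (hc : 0 < c) (h : A0 c P) {r : ℝ} (hr : 0 < r) :
    0 ≤ P r / c ^ 2 ∧ P r / c ^ 2 ≤ r := by
  refine ⟨div_nonneg (h.2.1 r hr) (sq_nonneg c), ?_⟩
  rw [div_le_iff₀ (by positivity)]
  linarith [h.le_mul hr]

/-- Under the smallness conditions on the initial contraction rate, `a` stays above `a₁` and `ρ`
stays below `ρ₁`. -/
theorem IsFriedmannSolution.lt_and_lt {c G Λ : ℝ} {P a ρ : ℝ → ℝ} {T a₁ ρ₁ k : ℝ} (hc : 0 < c)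
    (hA0 : A0 c P) (hT : 0 ≤ T) (h : IsFriedmannSolution c G Λ P a ρ (Icc 0 T))
    (ha₁ : 0 < a₁) (hk : 0 < k)
    (hκ : ∀ r, 0 < r → r ≤ ρ₁ →
      k ≤ -(4 * Real.pi * G / 3) * (r + 3 * P r / c ^ 2) + c ^ 2 * Λ / 3)
    (hsmall : a₁ < a 0 - 1 / (2 * (k * a₁)) * (min (deriv a 0) 0) ^ 2)
    (hsmall' : ρ 0 * exp (3 / (a₁ * (k * a₁)) * (min (deriv a 0) 0) ^ 2) < ρ₁) :
    a₁ < a T ∧ ρ T < ρ₁ := by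
  have hca : ContinuousOn a (Icc 0 T) := fun t ht =>
    (h t ht).2.2.1.continuousAt.continuousWithinAt
  have hcρ : ContinuousOn ρ (Icc 0 T) := fun t ht =>
    (h t ht).2.2.2.2.continuousAt.continuousWithinAt
  by_contra hbad
  set B := {t ∈ Icc 0 T | a t ≤ a₁ ∨ ρ₁ ≤ ρ t} with hB
  have hBc : IsCompact B := by
    have h1 : IsClosed {t ∈ Icc 0 T | a t ≤ a₁} :=
      isClosed_Icc.isClosed_le hca continuousOn_const
    have h2 : IsClosed {t ∈ Icc 0 T | ρ₁ ≤ ρ t} :=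
      isClosed_Icc.isClosed_le continuousOn_const hcρ
    refine isCompact_Icc.of_isClosed_subset ?_ (sep_subset (Icc 0 T) _)
    convert h1.union h2 using 1
    ext t
    simp only [hB, mem_ofPred_eq, mem_union]
    tauto
  have hBne : B.Nonempty := by
    refine ⟨T, ⟨hT, le_rfl⟩, ?_⟩
    by_contra! hcon
    exact hbad hcon
  obtain ⟨b, ⟨hbI, hbb⟩, hmin⟩ := hBc.exists_isLeast hBne
  have hgood : ∀ t ∈ Ico 0 b, a₁ < a t ∧ ρ t < ρ₁ := by
    intro t ht
    by_contra hcon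
    have : t ∈ B := by
      refine ⟨⟨ht.1, ht.2.le.trans hbI.2⟩, ?_⟩
      by_contra! h2
      exact hcon h2
    linarith [hmin this, ht.2]
  have hsub : Icc 0 b ⊆ Icc 0 T := Icc_subset_Icc_right hbI.2
  have hexp : ρ 0 < ρ₁ := by
    refine lt_of_le_of_lt (le_mul_of_one_le_right (h 0 ⟨le_rfl, hT⟩).2.1.le ?_) hsmall'
    exact one_le_exp (by positivity)
  have ha0 : a₁ < a 0 := by
    have : 0 ≤ 1 / (2 * (k * a₁)) * (min (deriv a 0) 0) ^ 2 := by positivity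
    linarith
  have hb0 : 0 < b := by
    rcases hbI.1.eq_or_lt with h0 | h0
    · rw [← h0] at hbb
      rcases hbb with h1 | h1 <;> linarith
    · exact h0
  have hclos : ∀ t ∈ Icc 0 b, a₁ ≤ a t ∧ ρ t ≤ ρ₁ := by
    intro t ht
    rcases ht.2.eq_or_lt with rfl | hlt
    · have hmem : Ico 0 t ∈ 𝓝[<] t := Ico_mem_nhdsLT hb0
      have ht' := h t (hsub ht)
      have h1 : Tendsto a (𝓝[<] t) (𝓝 (a t)) :=
        ht'.2.2.1.continuousAt.tendsto.mono_left nhdsWithin_le_nhds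
      have h2 : Tendsto ρ (𝓝[<] t) (𝓝 (ρ t)) :=
        ht'.2.2.2.2.continuousAt.tendsto.mono_left nhdsWithin_le_nhds
      constructor
      · refine ge_of_tendsto h1 ?_
        filter_upwards [hmem] with r hr using (hgood r hr).1.le
      · refine le_of_tendsto h2 ?_
        filter_upwards [hmem] with r hr using (hgood r hr).2.le
    · exact ⟨(hgood t ⟨ht.1, hlt⟩).1.le, (hgood t ⟨ht.1, hlt⟩).2.le⟩
  obtain ⟨hA, hR⟩ := bounds_of_acceleration (p := fun t => P (ρ t) / c ^ 2)
    (κ := fun t => -(4 * Real.pi * G / 3) * (ρ t + 3 * P (ρ t) / c ^ 2) + c ^ 2 * Λ / 3)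
    ha₁ hk hb0.le (fun t ht => (h t (hsub ht)).2.2.1.hasDerivAt)
    (fun t ht => (h t (hsub ht)).2.2.2.1) (fun t ht => (h t (hsub ht)).2.2.2.2)
    (fun t ht => hA0.div_mem hc (h t (hsub ht)).2.1) (fun t ht => (hclos t ht).1)
    (fun t ht => hκ _ (h t (hsub ht)).2.1 (hclos t ht).2)
  rcases hbb with h1 | h1 <;> linarith

/-- On a bounded time interval, a solution of the Friedmann system with `a ≥ a₁ > 0`, `ρ ≤ ρ₁` and
nonnegative acceleration converges to a point of the domain at the final time. -/
theorem IsFriedmannSolution.exists_tendsto {c G Λ : ℝ} {P a ρ : ℝ → ℝ} {T a₁ ρ₁ : ℝ} (hc : 0 < c)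
    (hG : 0 < G) (hΛ : 0 < Λ) (hA0 : A0 c P) (hT : 0 < T)
    (h : IsFriedmannSolution c G Λ P a ρ (Ico 0 T)) (ha₁ : 0 < a₁)
    (ha : ∀ t ∈ Ico 0 T, a₁ ≤ a t) (hρ : ∀ t ∈ Ico 0 T, ρ t ≤ ρ₁)
    (hκ : ∀ t ∈ Ico 0 T,
      0 ≤ -(4 * Real.pi * G / 3) * (ρ t + 3 * P (ρ t) / c ^ 2) + c ^ 2 * Λ / 3) :
    ∃ za zv zρ : ℝ, 0 < za ∧ 0 < zρ ∧ Tendsto a (𝓝[<] T) (𝓝 za) ∧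
      Tendsto (deriv a) (𝓝[<] T) (𝓝 zv) ∧ Tendsto ρ (𝓝[<] T) (𝓝 zρ) := by
  set κ : ℝ → ℝ := fun t =>
    -(4 * Real.pi * G / 3) * (ρ t + 3 * P (ρ t) / c ^ 2) + c ^ 2 * Λ / 3 with hκdef
  have h0 : (0 : ℝ) ∈ Ico 0 T := ⟨le_rfl, hT⟩
  have hapos : ∀ t ∈ Ico 0 T, 0 < a t := fun t ht => (h t ht).1
  have hda : ∀ t ∈ Ico 0 T, HasDerivAt a (deriv a t) t := fun t ht => (h t ht).2.2.1.hasDerivAt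
  have hdv : ∀ t ∈ Ico 0 T, HasDerivAt (deriv a) (κ t * a t) t := fun t ht => (h t ht).2.2.2.1
  have hdρ := fun t ht => (h t ht).2.2.2.2
  have hκle : ∀ t ∈ Ico 0 T, κ t ≤ c ^ 2 * Λ / 3 := by
    intro t ht
    have hp := hA0.2.1 _ (h t ht).2.1
    have hr := (h t ht).2.1
    have : 0 ≤ (4 * Real.pi * G / 3) * (ρ t + 3 * P (ρ t) / c ^ 2) := by positivity
    simp only [hκdef]
    linarith
  obtain ⟨q, hq0, hq⟩ : ∃ q : ℝ, 0 < q ∧ q ^ 2 = c ^ 2 * Λ / 3 :=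
    ⟨√(c ^ 2 * Λ / 3), by positivity, Real.sq_sqrt (by positivity)⟩
  have hvmono : MonotoneOn (deriv a) (Ico 0 T) :=
    monotoneOn_of_hasDerivAt_nonneg (convex_Ico 0 T) hdv
      fun t ht => mul_nonneg (hκ t ht) (hapos t ht).le
  have hgrow := antitoneOn_of_hasDerivAt_nonpos (convex_Ico 0 T)
    (f := fun t => (deriv a t + q * a t) * exp (-q * t))
    (f' := fun t => (κ t * a t - q ^ 2 * a t) * exp (-q * t))
    (fun t ht => by
      refine (((hdv t ht).add ((hda t ht).const_mul q)).mul
        (((hasDerivAt_id t).const_mul (-q)).exp)).congr_deriv ?_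
      simp only [id, Pi.add_apply]
      ring)
    (fun t ht => mul_nonpos_of_nonpos_of_nonneg (by
      have := mul_le_mul_of_nonneg_right (hκle t ht) (hapos t ht).le
      rw [hq]
      linarith) (exp_pos _).le)
  set C := |deriv a 0 + q * a 0| * exp (q * T) with hC
  have hsum : ∀ t ∈ Ico 0 T, deriv a t + q * a t ≤ C := by
    intro t ht
    have h1 := hgrow h0 ht ht.1
    simp only [mul_zero, exp_zero, mul_one] at h1
    have h2 : deriv a t + q * a t ≤ (deriv a 0 + q * a 0) * exp (q * t) := by
      have := mul_le_mul_of_nonneg_right h1 (exp_pos (q * t)).le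
      rwa [mul_assoc, ← exp_add, neg_mul, neg_add_cancel, exp_zero, mul_one] at this
    refine h2.trans ?_
    have h3 : exp (q * t) ≤ exp (q * T) := by
      have := ht.2.le
      gcongr
    exact mul_le_mul (le_abs_self _) h3 (exp_pos _).le (abs_nonneg _)
  have hC0 : 0 ≤ C := by positivity
  set M := C + |deriv a 0| with hM
  have hM0 : 0 ≤ M := by positivity
  have hvlow : ∀ t ∈ Ico 0 T, -|deriv a 0| ≤ deriv a t := fun t ht =>
    (neg_abs_le _).trans (hvmono h0 ht ht.1)
  have hvM : ∀ t ∈ Ico 0 T, |deriv a t| ≤ M := by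
    intro t ht
    have h1 := hsum t ht
    have h2 := mul_pos hq0 (hapos t ht)
    rw [abs_le]
    constructor <;> linarith [hvlow t ht, abs_nonneg (deriv a 0)]
  have haM : ∀ t ∈ Ico 0 T, a t ≤ M / q := by
    intro t ht
    rw [le_div_iff₀ hq0]
    linarith [hsum t ht, hvlow t ht]
  have hratio : ∀ t ∈ Ico 0 T, |deriv a t / a t| ≤ M / a₁ := by
    intro t ht
    rw [abs_div, abs_of_pos (hapos t ht)]
    exact div_le_div₀ hM0 (hvM t ht) ha₁ (ha t ht)
  have hρd : ∀ t ∈ Ico 0 T,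
      |-3 * (ρ t + P (ρ t) / c ^ 2) * (deriv a t / a t)| ≤ 6 * ρ t * (M / a₁) := by
    intro t ht
    have hr := (h t ht).2.1
    obtain ⟨hp0, hp1⟩ := hA0.div_mem hc hr
    rw [abs_mul]
    refine mul_le_mul ?_ (hratio t ht) (abs_nonneg _) (by positivity)
    rw [abs_le]
    constructor <;> linarith
  obtain ⟨za, hza⟩ := exists_tendsto_nhdsLT_of_hasDerivAt_bounded hT hda hvM
  obtain ⟨zv, hzv⟩ := exists_tendsto_nhdsLT_of_hasDerivAt_bounded hT hdv
    (C := q ^ 2 * (M / q)) (fun t ht => by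
      rw [abs_of_nonneg (mul_nonneg (hκ t ht) (hapos t ht).le), hq]
      exact mul_le_mul (hκle t ht) (haM t ht) (hapos t ht).le (by positivity))
  obtain ⟨zρ, hzρ⟩ := exists_tendsto_nhdsLT_of_hasDerivAt_bounded hT hdρ
    (C := 6 * ρ₁ * (M / a₁)) (fun t ht => (hρd t ht).trans (by
      have := hρ t ht
      gcongr))
  have hmem : Ico 0 T ∈ 𝓝[<] T := Ico_mem_nhdsLT hT
  have hza0 : a₁ ≤ za := ge_of_tendsto hza (by filter_upwards [hmem] with t ht using ha t ht)
  set l := 6 * (M / a₁) with hl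
  have hl0 : 0 ≤ l := by positivity
  have hρmono := monotoneOn_of_hasDerivAt_nonneg (convex_Ico 0 T)
    (f := fun t => ρ t * exp (l * t))
    (f' := fun t => (-3 * (ρ t + P (ρ t) / c ^ 2) * (deriv a t / a t) + ρ t * l) * exp (l * t))
    (fun t ht => by
      refine ((hdρ t ht).mul (((hasDerivAt_id t).const_mul l).exp)).congr_deriv ?_
      simp only [id]
      ring)
    (fun t ht => mul_nonneg (by
      have := (abs_le.1 (hρd t ht)).1
      rw [hl]
      linarith) (exp_pos _).le)
  have hρlow : ∀ t ∈ Ico 0 T, ρ 0 * exp (-(l * T)) ≤ ρ t := by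
    intro t ht
    have h1 := hρmono h0 ht ht.1
    simp only [mul_zero, exp_zero, mul_one] at h1
    have h2 : exp (l * t) ≤ exp (l * T) := by
      have := ht.2.le
      gcongr
    rw [exp_neg, ← div_eq_mul_inv, div_le_iff₀ (exp_pos _)]
    exact h1.trans (mul_le_mul_of_nonneg_left h2 (h t ht).2.1.le)
  have hzρ0 : ρ 0 * exp (-(l * T)) ≤ zρ :=
    ge_of_tendsto hzρ (by filter_upwards [hmem] with t ht using hρlow t ht)
  exact ⟨za, zv, zρ, ha₁.trans_le hza0, (mul_pos (h 0 h0).2.1 (exp_pos _)).trans_le hzρ0,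
    hza, hzv, hzρ⟩

/-- A global solution of the Friedmann system whose acceleration is bounded below by a positive
constant expands and dilutes indefinitely. -/
theorem IsFriedmannSolution.tendsto_atTop {c G Λ : ℝ} {P a ρ : ℝ → ℝ} {m : ℝ} (hA0 : A0 c P)
    (h : IsFriedmannSolution c G Λ P a ρ (Ici 0)) (hm : 0 < m)
    (hacc : ∀ t ∈ Ici (0 : ℝ),
      m ≤ (-(4 * Real.pi * G / 3) * (ρ t + 3 * P (ρ t) / c ^ 2) + c ^ 2 * Λ / 3) * a t) :
    Tendsto a atTop atTop ∧ Tendsto ρ atTop (𝓝 0) := by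
  have hvmono := monotoneOn_of_hasDerivAt_nonneg (convex_Ici (0 : ℝ))
    (f := fun t => deriv a t - m * t)
    (fun t ht => (h t ht).2.2.2.1.sub ((hasDerivAt_id t).const_mul m))
    (fun t ht => by linarith [hacc t ht])
  have hv : ∀ t ∈ Ici (0 : ℝ), deriv a 0 + m * t ≤ deriv a t := by
    intro t ht
    have := hvmono self_mem_Ici ht ht
    simp only [mul_zero, sub_zero] at this
    linarith
  obtain ⟨t₁, ht₁0, ht₁⟩ : ∃ t₁ : ℝ, 0 ≤ t₁ ∧ ∀ t, t₁ ≤ t → 1 ≤ deriv a t := by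
    have hlin : Tendsto (fun t : ℝ => deriv a 0 + m * t) atTop atTop :=
      tendsto_atTop_add_const_left _ _ (tendsto_id.const_mul_atTop hm)
    obtain ⟨t₁, ht₁⟩ := (hlin.eventually_ge_atTop 1).exists_forall_of_atTop
    exact ⟨max t₁ 0, le_max_right _ _, fun t ht =>
      (ht₁ t ((le_max_left _ _).trans ht)).trans (hv t ((le_max_right _ _).trans ht))⟩
  have hsub : ∀ t ∈ Ici t₁, t ∈ Ici (0 : ℝ) := fun t ht => ht₁0.trans ht
  have hamono := monotoneOn_of_hasDerivAt_nonneg (convex_Ici t₁)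
    (f := fun t => a t - t)
    (fun t ht => (h t (hsub t ht)).2.2.1.hasDerivAt.sub (hasDerivAt_id t))
    (fun t ht => by linarith [ht₁ t ht])
  have hatop : Tendsto a atTop atTop := by
    refine tendsto_atTop_mono' _ ?_ (tendsto_atTop_add_const_left _ (a t₁ - t₁) tendsto_id)
    filter_upwards [eventually_ge_atTop t₁] with t ht
    have := hamono self_mem_Ici ht ht
    simp only [id]
    linarith
  refine ⟨hatop, ?_⟩
  have hanti := antitoneOn_of_hasDerivAt_nonpos (convex_Ici t₁)
    (f := fun t => ρ t * a t ^ 3)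
    (f' := fun t => -(3 * (P (ρ t) / c ^ 2) * deriv a t * a t ^ 2))
    (fun t ht => by
      obtain ⟨ha, -, h1, -, h3⟩ := h t (hsub t ht)
      refine (h3.mul (h1.hasDerivAt.pow 3)).congr_deriv ?_
      have := ha.ne'
      simp only [Pi.pow_apply]
      field_simp
      ring)
    (fun t ht => by
      have h1 := hA0.2.1 _ (h t (hsub t ht)).2.1
      have h2 : 0 ≤ deriv a t := zero_le_one.trans (ht₁ t ht)
      have : 0 ≤ 3 * (P (ρ t) / c ^ 2) * deriv a t * a t ^ 2 := by positivity
      linarith)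
  have hlim : Tendsto (fun t => ρ t₁ * a t₁ ^ 3 / a t ^ 3) atTop (𝓝 0) :=
    tendsto_const_nhds.div_atTop ((tendsto_pow_atTop (by norm_num)).comp hatop)
  refine tendsto_of_tendsto_of_tendsto_of_le_of_le' tendsto_const_nhds hlim ?_ ?_
  · filter_upwards [eventually_ge_atTop 0] with t ht using (h t ht).2.1.le
  · filter_upwards [eventually_ge_atTop t₁] with t ht
    have ha := (h t (hsub t ht)).1
    rw [le_div_iff₀ (by positivity)]
    exact hanti self_mem_Ici ht ht

/-- Corollary 4: if `4πG(ρ₀ + 3P(ρ₀)/c²) < c²Λ`, then for all `ȧ₀ < 0` of sufficiently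
small absolute value the universe eventually expands: `t₊ = +∞` and `a(t) → +∞`,
`ρ(t) → 0` as `t → +∞`. -/
theorem expansion_of_small_initial_contraction
    (c G Λ : ℝ) (hc : 0 < c) (hG : 0 < G) (hΛ : 0 < Λ)
    (P : ℝ → ℝ) (hA0 : A0 c P)
    (a0 ρ0 : ℝ) (ha0pos : 0 < a0) (hρ0pos : 0 < ρ0)
    (hcond : 4 * Real.pi * G * (ρ0 + 3 * P ρ0 / c ^ 2) < c ^ 2 * Λ) :
    ∃ ε : ℝ, 0 < ε ∧
      ∀ adot0 : ℝ, -ε ≤ adot0 → adot0 < 0 →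
        ∀ (a ρ : ℝ → ℝ) (tm tp : EReal),
          IsMaximalSolution c G Λ P a ρ tm tp →
          a 0 = a0 → deriv a 0 = adot0 → ρ 0 = ρ0 →
          tp = ⊤ ∧
            Filter.Tendsto a Filter.atTop Filter.atTop ∧
            Filter.Tendsto ρ Filter.atTop (nhds 0) := by
  obtain ⟨ρ₁, k, ε, hρ₁, hk, hε, hκ, hsmall, hsmall'⟩ :=
    exists_thresholds hG hA0 ha0pos hρ0pos hcond
  refine ⟨ε, hε, fun adot0 hlow hneg a ρ tm tp hmax ha hda hρ => ?_⟩
  have ha₁ : 0 < a0 / 2 := by positivity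
  have hsq : (min (deriv a 0) 0) ^ 2 ≤ ε ^ 2 := by
    rw [hda, min_eq_left hneg.le]
    exact sq_le_sq' hlow (hneg.le.trans hε.le)
  have hs1 : a0 / 2 < a 0 - 1 / (2 * (k * (a0 / 2))) * (min (deriv a 0) 0) ^ 2 := by
    rw [ha]
    refine hsmall.trans_le ?_
    gcongr
  have hs2 : ρ 0 * exp (3 / (a0 / 2 * (k * (a0 / 2))) * (min (deriv a 0) 0) ^ 2) < ρ₁ := by
    rw [hρ]
    refine lt_of_le_of_lt ?_ hsmall'
    gcongr
  have htm := hmax.1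
  have hsol : ∀ T : ℝ, (T : EReal) < tp → IsFriedmannSolution c G Λ P a ρ (Icc 0 T) :=
    fun T hT t ht => hmax.2.2.1 t ⟨htm.trans_le (by exact_mod_cast ht.1),
      lt_of_le_of_lt (by exact_mod_cast ht.2) hT⟩
  have hbd : ∀ t : ℝ, 0 ≤ t → (t : EReal) < tp → a0 / 2 < a t ∧ ρ t < ρ₁ := fun t ht htp =>
    (hsol t htp).lt_and_lt hc hA0 ht ha₁ hk hκ hs1 hs2
  have htop : tp = ⊤ := by
    by_contra hne
    have hT : 0 < tp := hmax.2.1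
    lift tp to ℝ using ⟨hne, (EReal.bot_lt_zero.trans hT).ne'⟩ with T
    have hlt : ∀ t ∈ Ico 0 T, (t : EReal) < T := fun t ht => by exact_mod_cast ht.2
    have hsolT : IsFriedmannSolution c G Λ P a ρ (Ico 0 T) := fun t ht =>
      hsol t (hlt t ht) t ⟨ht.1, le_rfl⟩
    obtain ⟨za, zv, zρ, hza, hzρ, h1, h2, h3⟩ := hsolT.exists_tendsto hc hG hΛ hA0
      (by exact_mod_cast hT) ha₁ (fun t ht => (hbd t ht.1 (hlt t ht)).1.le)
      (fun t ht => (hbd t ht.1 (hlt t ht)).2.le)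
      (fun t ht => hk.le.trans (hκ _ (hsolT t ht).2.1 (hbd t ht.1 (hlt t ht)).2.le))
    exact hmax.not_tendsto hA0.1 hza hzρ h1 h2 h3
  subst htop
  have hglob : IsFriedmannSolution c G Λ P a ρ (Ici 0) := fun t ht =>
    hsol t (EReal.coe_lt_top t) t ⟨ht, le_rfl⟩
  refine ⟨rfl, hglob.tendsto_atTop hA0 (mul_pos hk ha₁) fun t ht => ?_⟩
  obtain ⟨h1, h2⟩ := hbd t ht (EReal.coe_lt_top t)
  have h3 := hκ _ (hglob t ht).2.1 h2.le
  exact mul_le_mul h3 h1.le ha₁.le (hk.le.trans h3)
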